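/- arXiv:2410.08951 — 2 statements merged into one kernel-verified Lean document; each statement's English description precedes it below -/
import Mathlib

section
/- Under the stated hypotheses on Φ and f, the following two relations hold among partial derivatives at 0: Y3_{x2}(0) + Y3_{x3}(0) + Y3_{y3}(0) = f(0)·G(0), and Y3_{x3}(0) + c·Y3_{y3}(0) = c̃·f(0)·G(0). -/
noncomputable section

/-- The model space `ℝ^13` with coordinates
`(t, x0, y0, x1, y1, x2, y2, x3, y3, x4, y4, x5, y5)`
indexed by `0, 1, ..., 12` respectively. -/
abbrev E13 := Fin 13 → ℝ

/-- The constant coordinate vector field `∂_u` of the `i`-th coordinate. -/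
def e (i : Fin 13) : E13 := Pi.single i 1

/-- Partial derivative of a scalar function `F` in the `i`-th coordinate
direction, at a point `p`. -/
def pd (F : E13 → ℝ) (i : Fin 13) (p : E13) : ℝ := fderiv ℝ F p (e i)

/-- The vector field `Z'_{1,a}` of the EKR pseudo-normal form for the
singularity class 1.2.2.1.2:
`Z'_{1,a} = ∂_{x4} + (a + y5)·∂_{y4} + x5·( ∂_{x2} + y3·∂_{y2} + (1 + x4)·∂_{x3}
 + (1 + y4)·∂_{y3} + x3·( ∂_{x1} + y2·∂_{y1} + x2·( ∂_t + x1·∂_{x0} + y1·∂_{y0} ) ) )`. -/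
def Z (a : ℝ) (p : E13) : E13 :=
  e 9 + (a + p 12) • e 10 +
    p 11 • (e 5 + p 8 • e 6 + (1 + p 9) • e 7 + (1 + p 10) • e 8 +
      p 7 • (e 3 + p 6 • e 4 + p 5 • (e 0 + p 3 • e 1 + p 4 • e 2)))

open Filter Topology

/-- A function invariant under translation by `w` has a `w`-invariant derivative. -/
theorem fderiv_add_of_forall_add_eq {F : E13 → ℝ} {w : E13} (h : ∀ q, F (q + w) = F q)
    (p : E13) : fderiv ℝ F (p + w) = fderiv ℝ F p := by
  rw [← fderiv_comp_add_right]
  simp only [h]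

/-- The derivative of a function vanishes along a direction in which the function is constant. -/
theorem fderiv_apply_eq_zero_of_forall_add_smul_eq {F : E13 → ℝ} {w p : E13}
    (h : ∀ s : ℝ, F (p + s • w) = F p) : fderiv ℝ F p w = 0 := by
  by_cases hF : DifferentiableAt ℝ F p
  · rw [← hF.lineDeriv_eq_fderiv, lineDeriv]
    simp [h]
  · simp [fderiv_zero_of_not_differentiableAt hF]

/-- Modulo `span {e 11, e 12}` all coordinates other than the last two are well defined. -/
theorem apply_eq_zero_of_mem_span {w : E13} (h : w ∈ Submodule.span ℝ ({e 11, e 12} : Set E13))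
    {i : Fin 13} (h11 : i ≠ 11) (h12 : i ≠ 12) : w i = 0 := by
  obtain ⟨a, b, rfl⟩ := Submodule.mem_span_pair.1 h
  simp [e, h11, h12]

/-- `Y3_{x2}(0) + Y3_{x3}(0) + Y3_{y3}(0) = f(0)·G(0)` and `Y3_{x3}(0) + c·Y3_{y3}(0) = c'·f(0)·G(0)`. -/
theorem level_Y3_relations_12212 (c c' : ℝ)
    (Φ : E13 → E13) (U : Set E13) (hU : IsOpen U) (h0U : (0 : E13) ∈ U)
    (hΦsmooth : ContDiffOn ℝ (⊤ : ℕ∞) Φ U) (hΦ0 : Φ 0 = 0)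
    (hdiffeo : Function.Bijective (fderiv ℝ Φ 0))
    -- the components `T, X0, Y0` (indices 0,1,2) depend only on `t, x0, y0`
    (htri0 : ∀ p q : E13, (∀ k : Fin 13, (k : ℕ) ≤ 2 → p k = q k) →
      ∀ i : Fin 13, (i : ℕ) ≤ 2 → Φ p i = Φ q i)
    -- for `1 ≤ j ≤ 5`, the components `Xj, Yj` (indices 2j+1, 2j+2)
    -- depend only on `t, x0, y0, x1, y1, ..., xj, yj`
    (htri : ∀ j : ℕ, 1 ≤ j → j ≤ 5 → ∀ p q : E13,
      (∀ k : Fin 13, (k : ℕ) ≤ 2 * j + 2 → p k = q k) →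
      ∀ i : Fin 13, ((i : ℕ) = 2 * j + 1 ∨ (i : ℕ) = 2 * j + 2) → Φ p i = Φ q i)
    (K H G : E13 → ℝ)
    (hKs : ContDiffOn ℝ (⊤ : ℕ∞) K U) (hHs : ContDiffOn ℝ (⊤ : ℕ∞) H U) (hGs : ContDiffOn ℝ (⊤ : ℕ∞) G U)
    (hK0 : K 0 ≠ 0) (hH0 : H 0 ≠ 0) (hG0 : G 0 ≠ 0)
    -- `X2 = x2·K`, `X3 = x3·H`, `X5 = x5·G`
    (hX2 : ∀ p ∈ U, Φ p 5 = p 5 * K p)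
    (hX3 : ∀ p ∈ U, Φ p 7 = p 7 * H p)
    (hX5 : ∀ p ∈ U, Φ p 11 = p 11 * G p)
    (f : E13 → ℝ) (hfs : ContDiffOn ℝ (⊤ : ℕ∞) f U) (hf0 : f 0 ≠ 0)
    -- `dΦ(p)·Z_{1,c}(p) − f(p)·Z_{1,c'}(Φ(p)) ∈ span{∂_{x5}, ∂_{y5}}` near 0
    (hconj : ∀ p ∈ U, fderiv ℝ Φ p (Z c p) - f p • Z c' (Φ p) ∈
      Submodule.span ℝ ({e 11, e 12} : Set E13)) :
    pd (fun p => Φ p 8) 5 0 + pd (fun p => Φ p 8) 7 0 + pd (fun p => Φ p 8) 8 0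
        = f 0 * G 0 ∧
      pd (fun p => Φ p 8) 7 0 + c * pd (fun p => Φ p 8) 8 0 = c' * (f 0 * G 0) := by
  have hUn : U ∈ 𝓝 (0 : E13) := hU.mem_nhds h0U
  have hdiff : ∀ p ∈ U, DifferentiableAt ℝ Φ p := fun p hp =>
    (hΦsmooth.contDiffAt (hU.mem_nhds hp)).differentiableAt (by simp)
  have hrow : ∀ p ∈ U, ∀ i : Fin 13, i ≠ 11 → i ≠ 12 →
      fderiv ℝ (fun q => Φ q i) p (Z c p) = f p * Z c' (Φ p) i := by
    intro p hp i h11 h12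
    have h := apply_eq_zero_of_mem_span (hconj p hp) h11 h12
    rw [fderiv_apply (hdiff p hp)]
    simpa [sub_eq_zero] using h
  -- `Φ q i` is unchanged when only `x4, y4, x5, y5` vary
  have hinv : ∀ i : Fin 13, i = 5 ∨ i = 7 ∨ i = 8 → ∀ q w : E13,
      (∀ k : Fin 13, (k : ℕ) ≤ 8 → w k = 0) → Φ (q + w) i = Φ q i := by
    rintro i (rfl | rfl | rfl) q w hw
    · exact htri 2 (by norm_num) (by norm_num) _ _
        (fun k hk => by simp [hw k (by omega)]) _ (by simp)
    · exact htri 3 (by norm_num) (by norm_num) _ _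
        (fun k hk => by simp [hw k (by omega)]) _ (by simp)
    · exact htri 3 (by norm_num) (by norm_num) _ _
        (fun k hk => by simp [hw k (by omega)]) _ (by simp)
  let v : E13 := e 9 + c • e 10
  -- the row equations divided by `x5`, at the points of the line `ℝ v`
  have hline : ∀ i : Fin 13, i = 5 ∨ i = 7 ∨ i = 8 → ∀ ζ : E13 → ℝ, Continuous ζ →
      (∀ q, Z c' q i = q 11 * ζ q) → ∀ s : ℝ, s • v ∈ U →
      pd (fun p => Φ p i) 5 0 + (1 + s) * pd (fun p => Φ p i) 7 0
        + (1 + s * c) * pd (fun p => Φ p i) 8 0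
        = f (s • v) * G (s • v) * ζ (Φ (s • v)) := by
    intro i hi ζ hζ hZ s hs
    have hγ : Continuous fun u : ℝ => s • v + u • e 11 := by fun_prop
    have hγ0 : s • v + (0 : ℝ) • e 11 = s • v := by simp
    have hnhds : U ∈ 𝓝 (s • v + (0 : ℝ) • e 11) := by rw [hγ0]; exact hU.mem_nhds hs
    have hcont : ContinuousAt (fun p => f p * G p * ζ (Φ p)) (s • v + (0 : ℝ) • e 11) :=
      ((hfs.continuousOn.continuousAt hnhds).mul (hGs.continuousOn.continuousAt hnhds)).mul
        (hζ.continuousAt.comp (hΦsmooth.continuousOn.continuousAt hnhds))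
    have hlim : Tendsto (fun u : ℝ => f (s • v + u • e 11) * G (s • v + u • e 11)
        * ζ (Φ (s • v + u • e 11))) (𝓝[≠] 0) (𝓝 (f (s • v) * G (s • v) * ζ (Φ (s • v)))) := by
      have := (ContinuousAt.comp (f := fun u : ℝ => s • v + u • e 11) (x := 0) hcont
        hγ.continuousAt).tendsto.mono_left (nhdsWithin_le_nhds (s := {0}ᶜ))
      simpa [Function.comp_def] using this
    refine tendsto_nhds_unique (tendsto_const_nhds.congr' ?_) hlim
    filter_upwards [self_mem_nhdsWithin,
      nhdsWithin_le_nhds (hγ.continuousAt.preimage_mem_nhds hnhds)] with u hu hpU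
    have hu : u ≠ 0 := hu
    replace hpU : s • v + u • e 11 ∈ U := hpU
    have hr := hrow _ hpU i (by rcases hi with rfl | rfl | rfl <;> decide)
      (by rcases hi with rfl | rfl | rfl <;> decide)
    have hw : ∀ k : Fin 13, (k : ℕ) ≤ 8 → (s • v + u • e 11) k = 0 := by
      intro k hk
      have h9 : k ≠ 9 := by rintro rfl; simp at hk
      have h10 : k ≠ 10 := by rintro rfl; simp at hk
      have h11 : k ≠ 11 := by rintro rfl; simp at hk
      simp [v, e, h9, h10, h11]
    have hfd := fderiv_add_of_forall_add_eq (F := fun q => Φ q i)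
      (fun q => hinv i hi q _ hw) 0
    rw [zero_add] at hfd
    have hA : ∀ k : Fin 13, 8 < (k : ℕ) → fderiv ℝ (fun q => Φ q i) 0 (e k) = 0 := by
      intro k hk
      refine fderiv_apply_eq_zero_of_forall_add_smul_eq fun r => hinv i hi _ _ fun l hl => ?_
      have : l ≠ k := by rintro rfl; omega
      simp [e, this]
    have hZp : Z c (s • v + u • e 11) = e 9 + c • e 10
        + u • (e 5 + (1 + s) • e 7 + (1 + s * c) • e 8) := by
      simp [Z, v, e]
    rw [hfd, hZ, hX5 _ hpU, hZp] at hr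
    have hp11 : (s • v + u • e 11) 11 = u := by simp [v, e]
    simp only [map_add, map_smul, smul_eq_mul, hp11, hA 9 (by simp), hA 10 (by simp)] at hr
    apply mul_left_cancel₀ hu
    simp only [pd]
    linear_combination hr
  have hcoord : ∀ i : Fin 13, i ≠ 11 → i ≠ 12 →
      HasDerivAt (fun s : ℝ => Φ (s • v) i) (f 0 * Z c' 0 i) 0 := by
    intro i h11 h12
    have hF : DifferentiableAt ℝ (fun q => Φ q i) 0 := differentiableAt_pi.1 (hdiff 0 h0U) i
    have h := hF.hasFDerivAt.hasLineDerivAt v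
    have hZ0 : Z c 0 = v := by simp [Z, v]
    have hr := hrow 0 h0U i h11 h12
    rw [hZ0, hΦ0] at hr
    rw [hr] at h
    simpa [HasLineDerivAt] using h
  have hnear : ∀ᶠ s : ℝ in 𝓝 0, s • v ∈ U := by
    have : Continuous fun s : ℝ => s • v := by fun_prop
    exact this.continuousAt.preimage_mem_nhds (by simpa using hUn)
  have hX2_zero : ∀ k : Fin 13, 6 < (k : ℕ) → pd (fun p => Φ p 5) k 0 = 0 := by
    intro k hk
    refine fderiv_apply_eq_zero_of_forall_add_smul_eq fun r => ?_
    refine htri 2 (by norm_num) (by norm_num) _ _ (fun l hl => ?_) _ (by simp)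
    have : l ≠ k := by rintro rfl; omega
    simp [e, this]
  have hX3_zero : ∀ k : Fin 13, k ≠ 7 → pd (fun p => Φ p 7) k 0 = 0 := by
    intro k hk
    have hHd : DifferentiableAt ℝ H 0 := (hHs.contDiffAt hUn).differentiableAt (by simp)
    have heq : (fun p => Φ p 7) =ᶠ[𝓝 0] fun p => p 7 * H p := by
      filter_upwards [hUn] with p hp using hX3 p hp
    have hd : HasFDerivAt (fun p : E13 => p 7) (ContinuousLinearMap.proj (R := ℝ) 7) 0 :=
      hasFDerivAt_apply 7 0
    rw [pd, heq.fderiv_eq, fderiv_fun_mul hd.differentiableAt hHd, hd.fderiv]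
    simp [e, hk.symm]
  -- on the line, `f * G` is constant and `X4` is the parameter
  have hfG : ∀ s : ℝ, s • v ∈ U → f (s • v) * G (s • v) = f 0 * G 0 := by
    have h (s : ℝ) (hs : s • v ∈ U) := hline 5 (by simp) (fun _ => 1) continuous_const
      (fun q => by simp [Z, e]) s hs
    simp only [hX2_zero 7 (by simp), hX2_zero 8 (by simp), mul_zero, add_zero, mul_one] at h
    intro s hs
    have h0 := h 0 (by simpa using h0U)
    rw [zero_smul] at h0
    rw [← h s hs, h0]
  have hX4 : ∀ s : ℝ, s • v ∈ U → Φ (s • v) 9 = s := by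
    have h (s : ℝ) (hs : s • v ∈ U) := hline 7 (by simp) (fun q => 1 + q 9) (by fun_prop)
      (fun q => by simp [Z, e]) s hs
    simp only [hX3_zero 5 (by decide), hX3_zero 8 (by decide), mul_zero, add_zero, zero_add] at h
    intro s hs
    have h0 := h 0 (by simpa using h0U)
    have hs' := h s hs
    rw [hfG s hs] at hs'
    simp only [zero_smul, hΦ0, Pi.zero_apply, add_zero, one_mul, mul_one] at h0
    rw [h0] at hs'
    apply mul_left_cancel₀ (mul_ne_zero hf0 hG0)
    linear_combination -hs'
  have hf1 : f 0 = 1 := by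
    have h := hcoord 9 (by decide) (by decide)
    have hid : (fun s : ℝ => Φ (s • v) 9) =ᶠ[𝓝 0] id := by
      filter_upwards [hnear] with s hs using hX4 s hs
    have := h.unique ((hasDerivAt_id (0 : ℝ)).congr_of_eventuallyEq hid)
    simpa [Z, e] using this
  have hY3 (s : ℝ) (hs : s • v ∈ U) := hline 8 (by simp) (fun q => 1 + q 10) (by fun_prop)
    (fun q => by simp [Z, e]) s hs
  have hsum := hY3 0 (by simpa using h0U)
  simp only [zero_smul, hΦ0, Pi.zero_apply, add_zero, one_mul, mul_one, zero_mul] at hsum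
  refine ⟨hsum, ?_⟩
  have hlin : (fun s : ℝ => f 0 * G 0 * Φ (s • v) 10) =ᶠ[𝓝 0]
      fun s => s * (pd (fun p => Φ p 8) 7 0 + c * pd (fun p => Φ p 8) 8 0) := by
    filter_upwards [hnear] with s hs
    have := hY3 s hs
    rw [hfG s hs] at this
    linear_combination hsum - this
  have h1 := (hcoord 10 (by decide) (by decide)).const_mul (f 0 * G 0)
  have h2 := ((hasDerivAt_id (0 : ℝ)).mul_const
    (pd (fun p => Φ p 8) 7 0 + c * pd (fun p => Φ p 8) 8 0)).congr_of_eventuallyEq hlin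
  have h := h1.unique h2
  have hZ10 : Z c' 0 10 = c' := by simp [Z, e]
  rw [hZ10, hf1] at h
  rw [hf1]
  linear_combination -h
end
end

section
/- Under the stated hypotheses on Φ and f, one has Y1_{x1}(0) = 0, Y1_{x1x1}(0) = 0, and consequently the partial derivative of the component Y2 with respect to x1 vanishes at the origin: Y2_{x1}(0) = 0. -/
noncomputable section

open Filter Topology

/-- A function that is locally constant along a line has vanishing derivative along it. -/
theorem fderiv_apply_eq_zero_of_eventually_const {F : E13 → ℝ} {p v : E13} {s a : ℝ}
    (h : ∀ᶠ t in 𝓝 s, F (p + t • v) = a) : fderiv ℝ F (p + s • v) v = 0 := by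
  by_cases hF : DifferentiableAt ℝ F (p + s • v)
  · have hline : HasDerivAt (fun t : ℝ => p + t • v) v s := by
      simpa using ((hasDerivAt_id s).smul_const v).const_add p
    have hcomp := hF.hasFDerivAt.comp_hasDerivAt s hline
    exact hcomp.unique ((hasDerivAt_const s a).congr_of_eventuallyEq h)
  · simp [fderiv_zero_of_not_differentiableAt hF]

/-- A scalar function that ignores the `k`-th coordinate has zero `k`-th partial derivative. -/
theorem pd_eq_zero_of_const {F : E13 → ℝ} {k : Fin 13} {p : E13}
    (h : ∀ t : ℝ, F (p + t • e k) = F p) : pd F k p = 0 := by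
  simpa [pd] using fderiv_apply_eq_zero_of_eventually_const (s := 0) (Eventually.of_forall h)

theorem add_smul_e_apply_of_ne {p : E13} {t : ℝ} {j k : Fin 13} (h : j ≠ k) :
    (p + t • e k) j = p j := by
  simp [e, Pi.single_eq_of_ne h]

theorem apply_eq_of_sub_mem_span {v w : E13}
    (h : v - w ∈ Submodule.span ℝ ({e 11, e 12} : Set E13)) {i : Fin 13}
    (h11 : i ≠ 11) (h12 : i ≠ 12) : v i = w i := by
  obtain ⟨a, b, hab⟩ := Submodule.mem_span_pair.1 h
  have hi := congrFun hab i
  simp [e, Pi.single_eq_of_ne h11, Pi.single_eq_of_ne h12] at hi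
  linarith

/-- The derivative of `F` along `Z` in terms of partial derivatives. -/
theorem fderiv_apply_Z (F : E13 → ℝ) (a : ℝ) (p : E13) :
    fderiv ℝ F p (Z a p) = pd F 9 p + (a + p 12) * pd F 10 p +
      p 11 * (pd F 5 p + p 8 * pd F 6 p + (1 + p 9) * pd F 7 p + (1 + p 10) * pd F 8 p +
        p 7 * (pd F 3 p + p 6 * pd F 4 p +
          p 5 * (pd F 0 p + p 3 * pd F 1 p + p 4 * pd F 2 p))) := by
  simp only [Z, pd, map_add, map_smul, smul_eq_mul]

theorem Z_apply_two (a : ℝ) (p : E13) : Z a p 2 = p 11 * (p 7 * (p 5 * p 4)) := by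
  simp [Z, e]

theorem Z_apply_four (a : ℝ) (p : E13) : Z a p 4 = p 11 * (p 7 * p 6) := by
  simp [Z, e]

/-- The curve `ε ↦ s ∂_{x1} + ε (∂_{x2} + ∂_{x3} + ∂_{x5})`. -/
def transverseCurve (s ε : ℝ) : E13 := s • e 3 + ε • (e 5 + e 7 + e 11)

theorem continuous_transverseCurve (s : ℝ) : Continuous (transverseCurve s) := by
  unfold transverseCurve
  fun_prop

theorem transverseCurve_zero (s : ℝ) : transverseCurve s 0 = s • e 3 := by
  simp [transverseCurve]

/-- Two functions continuous at `s ∂_{x1}` and equal along the transverse curve away from `ε = 0`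
agree at `s ∂_{x1}`. -/
theorem eq_of_eventually_eq_transverseCurve {A B : E13 → ℝ} {U : Set E13} (hU : IsOpen U) {s : ℝ}
    (hs : s • e 3 ∈ U) (hA : ContinuousOn A U) (hB : ContinuousOn B U)
    (h : ∀ ε : ℝ, ε ≠ 0 → transverseCurve s ε ∈ U →
      A (transverseCurve s ε) = B (transverseCurve s ε)) :
    A (s • e 3) = B (s • e 3) := by
  have hγ : Tendsto (transverseCurve s) (𝓝[≠] 0) (𝓝 (s • e 3)) := by
    have := (continuous_transverseCurve s).tendsto 0
    rw [transverseCurve_zero] at this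
    exact this.mono_left nhdsWithin_le_nhds
  have hmem := hU.mem_nhds hs
  refine tendsto_nhds_unique_of_eventuallyEq ((hA.continuousAt hmem).tendsto.comp hγ)
    ((hB.continuousAt hmem).tendsto.comp hγ) ?_
  filter_upwards [hγ.eventually hmem, self_mem_nhdsWithin] with ε hε hne
  exact h ε hne hε

theorem continuousOn_pd {F : E13 → ℝ} {U : Set E13} (hU : IsOpen U)
    (hF : ContDiffOn ℝ (⊤ : ℕ∞) F U) (k : Fin 13) : ContinuousOn (pd F k) U :=
  (hF.continuousOn_fderiv_of_isOpen hU (by simp)).clm_apply continuousOn_const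

/-- `Y1_{x1}(0) = 0`, `Y1_{x1x1}(0) = 0`, and consequently `Y2_{x1}(0) = 0`. -/
theorem observation_b_12212 (c c' : ℝ)
    (Φ : E13 → E13) (U : Set E13) (hU : IsOpen U) (h0U : (0 : E13) ∈ U)
    (hΦsmooth : ContDiffOn ℝ (⊤ : ℕ∞) Φ U) (hΦ0 : Φ 0 = 0)
    (hdiffeo : Function.Bijective (fderiv ℝ Φ 0))
    -- the components `T, X0, Y0` (indices 0,1,2) depend only on `t, x0, y0`
    (htri0 : ∀ p q : E13, (∀ k : Fin 13, (k : ℕ) ≤ 2 → p k = q k) →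
      ∀ i : Fin 13, (i : ℕ) ≤ 2 → Φ p i = Φ q i)
    -- for `1 ≤ j ≤ 5`, the components `Xj, Yj` (indices 2j+1, 2j+2)
    -- depend only on `t, x0, y0, x1, y1, ..., xj, yj`
    (htri : ∀ j : ℕ, 1 ≤ j → j ≤ 5 → ∀ p q : E13,
      (∀ k : Fin 13, (k : ℕ) ≤ 2 * j + 2 → p k = q k) →
      ∀ i : Fin 13, ((i : ℕ) = 2 * j + 1 ∨ (i : ℕ) = 2 * j + 2) → Φ p i = Φ q i)
    (K H G : E13 → ℝ)
    (hKs : ContDiffOn ℝ (⊤ : ℕ∞) K U) (hHs : ContDiffOn ℝ (⊤ : ℕ∞) H U) (hGs : ContDiffOn ℝ (⊤ : ℕ∞) G U)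
    (hK0 : K 0 ≠ 0) (hH0 : H 0 ≠ 0) (hG0 : G 0 ≠ 0)
    -- `X2 = x2·K`, `X3 = x3·H`, `X5 = x5·G`
    (hX2 : ∀ p ∈ U, Φ p 5 = p 5 * K p)
    (hX3 : ∀ p ∈ U, Φ p 7 = p 7 * H p)
    (hX5 : ∀ p ∈ U, Φ p 11 = p 11 * G p)
    (f : E13 → ℝ) (hfs : ContDiffOn ℝ (⊤ : ℕ∞) f U) (hf0 : f 0 ≠ 0)
    -- `dΦ(p)·Z_{1,c}(p) − f(p)·Z_{1,c'}(Φ(p)) ∈ span{∂_{x5}, ∂_{y5}}` near 0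
    (hconj : ∀ p ∈ U, fderiv ℝ Φ p (Z c p) - f p • Z c' (Φ p) ∈
      Submodule.span ℝ ({e 11, e 12} : Set E13)) :
    pd (fun p => Φ p 4) 3 0 = 0 ∧ pd (pd (fun p => Φ p 4) 3) 3 0 = 0 ∧
      pd (fun p => Φ p 6) 3 0 = 0 := by
  have hΦi : ∀ i : Fin 13, ContDiffOn ℝ (⊤ : ℕ∞) (fun p => Φ p i) U :=
    fun i => contDiffOn_pi.1 hΦsmooth i
  have hconj_apply : ∀ i : Fin 13, i ≠ 11 → i ≠ 12 → ∀ p ∈ U,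
      fderiv ℝ (fun q => Φ q i) p (Z c p) = f p * Z c' (Φ p) i := by
    intro i h11 h12 p hp
    have hd : DifferentiableAt ℝ Φ p :=
      (hΦsmooth.contDiffAt (hU.mem_nhds hp)).differentiableAt (by simp)
    have hi := apply_eq_of_sub_mem_span (hconj p hp) h11 h12
    rw [fderiv_apply hd]
    simpa using hi
  have hY0_indep : ∀ k : Fin 13, 3 ≤ (k : ℕ) → ∀ p, ∀ t : ℝ, Φ (p + t • e k) 2 = Φ p 2 := by
    intro k hk p t
    refine htri0 _ _ (fun j hj => add_smul_e_apply_of_ne ?_) 2 (by decide)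
    rintro rfl
    omega
  have hY0 : ∀ k : Fin 13, 3 ≤ (k : ℕ) → ∀ p, pd (fun q => Φ q 2) k p = 0 :=
    fun k hk p => pd_eq_zero_of_const (hY0_indep k hk p)
  have hY1 : ∀ k : Fin 13, 5 ≤ (k : ℕ) → ∀ p, pd (fun q => Φ q 4) k p = 0 := by
    intro k hk p
    refine pd_eq_zero_of_const fun t => ?_
    refine htri 1 le_rfl (by norm_num) _ _ (fun j hj => add_smul_e_apply_of_ne ?_) 4
      (Or.inr (by decide))
    rintro rfl
    omega
  have hY0_line : ∀ (k : Fin 13) (s : ℝ),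
      pd (fun q => Φ q 2) k (s • e 3) = pd (fun q => Φ q 2) k 0 := by
    intro k s
    have hshift : (fun q => Φ (q + s • e 3) 2) = fun q => Φ q 2 :=
      funext fun q => hY0_indep 3 (by decide) q s
    have := fderiv_comp_add_right (𝕜 := ℝ) (f := fun q => Φ q 2) (x := 0) (s • e 3)
    rw [hshift, zero_add] at this
    simp only [pd, this]
  have hfc := hfs.continuousOn
  have hGc := hGs.continuousOn
  have hHc := hHs.continuousOn
  have hKc := hKs.continuousOn
  have hline : Tendsto (fun s : ℝ => s • e 3) (𝓝 0) (𝓝 0) := by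
    have : Continuous fun s : ℝ => s • e 3 := by fun_prop
    simpa using this.tendsto 0
  -- The `∂_{y0}`-component of the conjugacy, along the `x1`-axis.
  have heq_Y0 : ∀ s : ℝ, s • e 3 ∈ U →
      pd (fun q => Φ q 2) 0 0 + s * pd (fun q => Φ q 2) 1 0 =
        f (s • e 3) * G (s • e 3) * H (s • e 3) * K (s • e 3) * Φ (s • e 3) 4 := by
    intro s hs
    rw [← hY0_line 0 s, ← hY0_line 1 s]
    refine eq_of_eventually_eq_transverseCurve
      (A := fun p => pd (fun q => Φ q 2) 0 p + s * pd (fun q => Φ q 2) 1 p)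
      (B := fun p => f p * G p * H p * K p * Φ p 4) hU hs
      ((continuousOn_pd hU (hΦi 2) 0).add (continuousOn_const.mul (continuousOn_pd hU (hΦi 2) 1)))
      ((((hfc.mul hGc).mul hHc).mul hKc).mul (hΦi 4).continuousOn) ?_
    intro ε hε hp
    have h := hconj_apply 2 (by decide) (by decide) _ hp
    rw [fderiv_apply_Z, Z_apply_two, hX2 _ hp, hX3 _ hp, hX5 _ hp, hY0 3 (by decide),
      hY0 4 (by decide), hY0 5 (by decide), hY0 6 (by decide), hY0 7 (by decide),
      hY0 8 (by decide), hY0 9 (by decide), hY0 10 (by decide)] at h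
    have h3 : transverseCurve s ε 3 = s := by simp [transverseCurve, e]
    have h4 : transverseCurve s ε 4 = 0 := by simp [transverseCurve, e]
    have h5 : transverseCurve s ε 5 = ε := by simp [transverseCurve, e]
    have h7 : transverseCurve s ε 7 = ε := by simp [transverseCurve, e]
    have h11 : transverseCurve s ε 11 = ε := by simp [transverseCurve, e]
    rw [h3, h4, h5, h7, h11] at h
    refine mul_left_cancel₀ (pow_ne_zero 3 hε) ?_
    linear_combination h
  -- The `∂_{y1}`-component of the conjugacy, along the `x1`-axis.
  have heq_Y1 : ∀ s : ℝ, s • e 3 ∈ U →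
      pd (fun q => Φ q 4) 3 (s • e 3) =
        f (s • e 3) * G (s • e 3) * H (s • e 3) * Φ (s • e 3) 6 := by
    intro s hs
    have hx2 : ContinuousOn (fun p : E13 => p 5) U := (continuous_apply 5).continuousOn
    have h := eq_of_eventually_eq_transverseCurve
      (A := fun p => pd (fun q => Φ q 4) 3 p +
        p 5 * (pd (fun q => Φ q 4) 0 p + s * pd (fun q => Φ q 4) 1 p))
      (B := fun p => f p * G p * H p * Φ p 6) hU hs
      ((continuousOn_pd hU (hΦi 4) 3).add (hx2.mul ((continuousOn_pd hU (hΦi 4) 0).add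
        (continuousOn_const.mul (continuousOn_pd hU (hΦi 4) 1)))))
      (((hfc.mul hGc).mul hHc).mul (hΦi 6).continuousOn) ?_
    · simpa [e, Pi.single_apply] using h
    intro ε hε hp
    have h := hconj_apply 4 (by decide) (by decide) _ hp
    rw [fderiv_apply_Z, Z_apply_four, hX3 _ hp, hX5 _ hp, hY1 5 (by decide), hY1 6 (by decide),
      hY1 7 (by decide), hY1 8 (by decide), hY1 9 (by decide), hY1 10 (by decide)] at h
    have h3 : transverseCurve s ε 3 = s := by simp [transverseCurve, e]
    have h4 : transverseCurve s ε 4 = 0 := by simp [transverseCurve, e]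
    have h5 : transverseCurve s ε 5 = ε := by simp [transverseCurve, e]
    have h6 : transverseCurve s ε 6 = 0 := by simp [transverseCurve, e]
    have h7 : transverseCurve s ε 7 = ε := by simp [transverseCurve, e]
    have h11 : transverseCurve s ε 11 = ε := by simp [transverseCurve, e]
    rw [h3, h4, h5, h6, h7, h11] at h
    simp only [h5]
    refine mul_left_cancel₀ (pow_ne_zero 2 hε) ?_
    linear_combination h
  have hU0 := hU.mem_nhds h0U
  have hlineU : ∀ᶠ s : ℝ in 𝓝 0, s • e 3 ∈ U := hline.eventually hU0
  have hne : ∀ᶠ s : ℝ in 𝓝 0,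
      f (s • e 3) ≠ 0 ∧ G (s • e 3) ≠ 0 ∧ H (s • e 3) ≠ 0 ∧ K (s • e 3) ≠ 0 :=
    hline.eventually (((hfc.continuousAt hU0).eventually_ne hf0).and
      (((hGc.continuousAt hU0).eventually_ne hG0).and
        (((hHc.continuousAt hU0).eventually_ne hH0).and
          ((hKc.continuousAt hU0).eventually_ne hK0))))
  have hY1x1 : pd (fun p => Φ p 4) 3 0 = 0 := by
    have h := heq_Y1 0 (by simpa using h0U)
    simpa [hΦ0] using h
  have ha : pd (fun q => Φ q 2) 0 0 = 0 := by
    have h := heq_Y0 0 (by simpa using h0U)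
    simpa [hΦ0] using h
  have hb : pd (fun q => Φ q 2) 1 0 = 0 := by
    have hdiff : ∀ {F : E13 → ℝ}, ContDiffOn ℝ (⊤ : ℕ∞) F U → DifferentiableAt ℝ F 0 :=
      fun hF => (hF.contDiffAt hU0).differentiableAt (by simp)
    have hD : DifferentiableAt ℝ (fun p => f p * G p * H p * K p) 0 :=
      hdiff (((hfs.mul hGs).mul hHs).mul hKs)
    have hprod := hD.hasFDerivAt.mul (hdiff (hΦi 4)).hasFDerivAt
    have hray : HasDerivAt (fun s : ℝ => s • e 3) (e 3) 0 := by
      simpa using (hasDerivAt_id (0 : ℝ)).smul_const (e 3)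
    have hcomp := HasFDerivAt.comp_hasDerivAt_of_eq 0 hprod hray (by simp)
    have hlin : HasDerivAt (fun s : ℝ => pd (fun q => Φ q 2) 0 0 + s * pd (fun q => Φ q 2) 1 0)
        (pd (fun q => Φ q 2) 1 0) 0 := by
      simpa using ((hasDerivAt_id (0 : ℝ)).mul_const (pd (fun q => Φ q 2) 1 0)).const_add
        (pd (fun q => Φ q 2) 0 0)
    have h := hlin.unique (hcomp.congr_of_eventuallyEq (hlineU.mono heq_Y0))
    have hz : fderiv ℝ (fun p => Φ p 4) 0 (e 3) = 0 := hY1x1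
    simpa [hΦ0, hz] using h
  -- `Y1`, hence `Y1_{x1}` and `Y2`, vanish on the `x1`-axis near the origin.
  have hY1_line : ∀ᶠ s : ℝ in 𝓝 0, Φ (s • e 3) 4 = 0 := by
    filter_upwards [hlineU, hne] with s hs ⟨hf, hG, hH, hK⟩
    have h := heq_Y0 s hs
    rw [ha, hb] at h
    simpa [hf, hG, hH, hK] using h.symm
  have hY1x1_line : ∀ᶠ s : ℝ in 𝓝 0, pd (fun p => Φ p 4) 3 (s • e 3) = 0 := by
    filter_upwards [hY1_line.eventually_nhds] with s hs
    simpa [pd] using fderiv_apply_eq_zero_of_eventually_const (F := fun p => Φ p 4) (p := 0)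
      (v := e 3) (by simpa using hs)
  have hY2_line : ∀ᶠ s : ℝ in 𝓝 0, Φ (s • e 3) 6 = 0 := by
    filter_upwards [hlineU, hne, hY1x1_line] with s hs ⟨hf, hG, hH, _⟩ hz
    have h := heq_Y1 s hs
    rw [hz] at h
    simpa [hf, hG, hH] using h.symm
  have hpd : ∀ F : E13 → ℝ, (∀ᶠ s : ℝ in 𝓝 0, F (s • e 3) = 0) → pd F 3 0 = 0 := by
    intro F hF
    simpa [pd] using fderiv_apply_eq_zero_of_eventually_const (F := F) (p := 0) (s := 0)
      (v := e 3) (by simpa using hF)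
  exact ⟨hY1x1, hpd _ hY1x1_line, hpd _ hY2_line⟩
end
end
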